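/- Let a₀, …, aₙ : ℤ → R and let A = Σ_{i=0}^{n} M_{a_i}∘Δ^i be a local difference operator. Then there exist c₀, …, c_{n-1} : ℤ → R such that, as R-linear operators on V, J∘A = Σ_{i=0}^{n-1} M_{c_i}∘Δ^i + J∘M_c, where c = Σ_{i=0}^{n} (Δ*)^i(a_i) and (Δ*f)(m) = f(m-1) - f(m). (This realizes the decomposition of Δ⁻¹A into its local part and its strictly negative part Δ⁻¹∘P₀(A*) underlying the residue formulas P₋(Δ⁻¹A) and res(Δ⁻¹A) = Λ⁻¹P₀(A*).) -/

import Mathlib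

open Finset

/-- A function `ℤ → R` has support bounded below. -/
def SuppBddBelow {A : Type*} [Zero A] (f : ℤ → A) : Prop :=
  ∃ M : ℤ, ∀ n : ℤ, n < M → f n = 0

/-- The difference operator `(Δ f)(n) = f(n+1) - f(n)`. -/
def Del {A : Type*} [AddCommGroup A] (f : ℤ → A) : ℤ → A := fun n => f (n + 1) - f n

/-- The formal adjoint of the difference operator, `(Δ* f)(n) = f(n-1) - f(n)`. -/
def DelStar {A : Type*} [AddCommGroup A] (f : ℤ → A) : ℤ → A := fun n => f (n - 1) - f n

/-- The summation operator `(J f)(n) = ∑_{m < n} f(m)` (a finite sum when the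
support of `f` is bounded below, realized via `finsum`). -/
noncomputable def Jop {A : Type*} [AddCommMonoid A] (f : ℤ → A) : ℤ → A :=
  fun n => ∑ᶠ (m : ℤ) (_ : m < n), f m

theorem SuppBddBelow.finite_Iio_inter_support {A : Type*} [Zero A] {f : ℤ → A}
    (hf : SuppBddBelow f) (k : ℤ) : (Set.Iio k ∩ Function.support f).Finite := by
  obtain ⟨M, hM⟩ := hf
  refine (Set.finite_Ico M k).subset fun m hm => ⟨?_, hm.1⟩
  by_contra h
  exact hm.2 (hM m (not_le.mp h))

theorem SuppBddBelow.mul_left {R : Type*} [MulZeroClass R] {f : ℤ → R}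
    (hf : SuppBddBelow f) (h : ℤ → R) : SuppBddBelow fun m => h m * f m := by
  obtain ⟨M, hM⟩ := hf
  exact ⟨M, fun m hm => by simp [hM m hm]⟩

theorem SuppBddBelow.add {A : Type*} [AddMonoid A] {f g : ℤ → A}
    (hf : SuppBddBelow f) (hg : SuppBddBelow g) : SuppBddBelow fun m => f m + g m := by
  obtain ⟨M, hM⟩ := hf
  obtain ⟨N, hN⟩ := hg
  exact ⟨min M N, fun m hm => by simp [hM m (by omega), hN m (by omega)]⟩

theorem SuppBddBelow.sum {A ι : Type*} [AddCommMonoid A] (s : Finset ι) {f : ι → ℤ → A}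
    (hf : ∀ i, SuppBddBelow (f i)) : SuppBddBelow fun m => ∑ i ∈ s, f i m := by
  classical
  induction s using Finset.induction_on with
  | empty => exact ⟨0, fun _ _ => by simp⟩
  | insert i s hi ih => simpa only [Finset.sum_insert hi] using (hf i).add ih

theorem SuppBddBelow.comp_add_one {A : Type*} [Zero A] {f : ℤ → A}
    (hf : SuppBddBelow f) : SuppBddBelow fun m => f (m + 1) := by
  obtain ⟨M, hM⟩ := hf
  exact ⟨M - 1, fun m hm => hM _ (by omega)⟩

theorem SuppBddBelow.del {A : Type*} [AddCommGroup A] {f : ℤ → A}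
    (hf : SuppBddBelow f) : SuppBddBelow (Del f) := by
  obtain ⟨M, hM⟩ := hf
  exact ⟨M - 1, fun m hm => by simp [Del, hM m (by omega), hM (m + 1) (by omega)]⟩

theorem SuppBddBelow.del_iterate {A : Type*} [AddCommGroup A] {f : ℤ → A}
    (hf : SuppBddBelow f) (i : ℕ) : SuppBddBelow (Del^[i] f) := by
  induction i with
  | zero => exact hf
  | succ i ih => simpa only [Function.iterate_succ_apply'] using ih.del

theorem Jop_add {A : Type*} [AddCommMonoid A] {f g : ℤ → A}
    (hf : SuppBddBelow f) (hg : SuppBddBelow g) (k : ℤ) :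
    Jop (fun m => f m + g m) k = Jop f k + Jop g k :=
  finsum_mem_add_distrib' (hf.finite_Iio_inter_support k) (hg.finite_Iio_inter_support k)

theorem Jop_sum {A ι : Type*} [AddCommMonoid A] (s : Finset ι) {f : ι → ℤ → A}
    (hf : ∀ i, SuppBddBelow (f i)) (k : ℤ) :
    Jop (fun m => ∑ i ∈ s, f i m) k = ∑ i ∈ s, Jop (f i) k := by
  classical
  induction s using Finset.induction_on with
  | empty => simp [Jop]
  | insert i s hi ih =>
    simp only [Finset.sum_insert hi]
    rw [Jop_add (hf i) (SuppBddBelow.sum s hf), ih]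

theorem Jop_add_one {A : Type*} [AddCommMonoid A] {f : ℤ → A}
    (hf : SuppBddBelow f) (k : ℤ) : Jop f (k + 1) = f k + Jop f k := by
  have h : Set.Iio (k + 1) = insert k (Set.Iio k) := by
    ext m
    simp only [Set.mem_Iio, Set.mem_insert_iff]
    omega
  change ∑ᶠ m ∈ Set.Iio (k + 1), f m = f k + ∑ᶠ m ∈ Set.Iio k, f m
  rw [h, finsum_mem_insert' f (by simp) (hf.finite_Iio_inter_support k)]

theorem Jop_comp_add_one {A : Type*} [AddCommMonoid A] (f : ℤ → A) (k : ℤ) :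
    Jop (fun m => f (m + 1)) k = Jop f (k + 1) := by
  have h := finsum_comp_equiv (Equiv.addRight (1 : ℤ))
    (f := fun m => ∑ᶠ _ : m < k + 1, f m)
  simpa [Jop] using h

/-- Summation by parts. -/
theorem Jop_mul_del {R : Type*} [CommRing R] (h : ℤ → R) {u : ℤ → R}
    (hu : SuppBddBelow u) (k : ℤ) :
    Jop (fun m => h m * Del u m) k
      = h (k - 1) * u k + Jop (fun m => DelStar h m * u m) k := by
  have hw : SuppBddBelow fun m => h (m - 1) * u m := hu.mul_left _
  have key : Jop (fun m => h m * Del u m + h (m - 1) * u m) k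
      = Jop (fun m => h (m + 1 - 1) * u (m + 1) + DelStar h m * u m) k := by
    congr 1
    funext m
    simp only [Del, DelStar, add_sub_cancel_right]
    ring
  rw [Jop_add (hu.del.mul_left h) hw, Jop_add hw.comp_add_one (hu.mul_left _),
    Jop_comp_add_one fun m => h (m - 1) * u m, Jop_add_one hw] at key
  linear_combination key

/-- Iterated summation by parts. -/
theorem Jop_mul_del_iterate {R : Type*} [CommRing R] (i : ℕ) (h : ℤ → R) {g : ℤ → R}
    (hg : SuppBddBelow g) (k : ℤ) :
    Jop (fun m => h m * Del^[i] g m) k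
      = (∑ j ∈ Finset.range i, DelStar^[i - 1 - j] h (k - 1) * Del^[j] g k)
        + Jop (fun m => DelStar^[i] h m * g m) k := by
  induction i generalizing h with
  | zero => simp
  | succ i ih =>
    simp only [Function.iterate_succ_apply' Del]
    rw [Jop_mul_del h (hg.del_iterate i), ih, Finset.sum_range_succ]
    have hs : ∀ j ∈ Finset.range i, DelStar^[i + 1 - 1 - j] h (k - 1) * Del^[j] g k
        = DelStar^[i - 1 - j] (DelStar h) (k - 1) * Del^[j] g k := fun j hj => by
      have hj := Finset.mem_range.mp hj
      rw [← Function.iterate_succ_apply, show (i - 1 - j).succ = i + 1 - 1 - j by omega]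
    rw [Finset.sum_congr rfl hs]
    simp only [Function.iterate_succ_apply, add_tsub_cancel_right, tsub_self,
      Function.iterate_zero, id_eq]
    ring

/-- for a local difference operator `A = Σ_{i=0}^{n} M_{a_i}∘Δⁱ`, there
exist `c₀, …, c_{n-1}` such that, on functions with support bounded below,
`J∘A = Σ_{i=0}^{n-1} M_{c_i}∘Δⁱ + J∘M_c` with `c = Σ_{i=0}^{n} (Δ*)ⁱ(a_i)`. -/
theorem stmt6 {R : Type*} [CommRing R] (n : ℕ) (a : ℕ → ℤ → R) :
    ∃ c : ℕ → ℤ → R,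
      ∀ g : ℤ → R, SuppBddBelow g → ∀ k : ℤ,
        Jop (fun j => ∑ i ∈ Finset.range (n + 1), a i j * Del^[i] g j) k
          = (∑ i ∈ Finset.range n, c i k * Del^[i] g k)
              + Jop (fun j => (∑ i ∈ Finset.range (n + 1), DelStar^[i] (a i) j) * g j) k := by
  refine ⟨fun j k => ∑ i ∈ Finset.Ico (j + 1) (n + 1), DelStar^[i - 1 - j] (a i) (k - 1),
    fun g hg k => ?_⟩
  simp only [Finset.sum_mul]
  rw [Jop_sum _ fun i => (hg.del_iterate i).mul_left (a i), Jop_sum _ fun i => hg.mul_left _,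
    Finset.sum_congr rfl fun i _ => Jop_mul_del_iterate i (a i) hg k, Finset.sum_add_distrib]
  congr 1
  refine Finset.sum_comm' fun i j => ?_
  simp only [Finset.mem_range, Finset.mem_Ico]
  omega
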